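/- Let λ > 0, and for n ≥ 2 let b_n be the unique real number with F_λ(b_n) = 1 - 1/n. Define h_n(x) = n log F_λ(b_n + x/b_n) + e^{-x}. Then for every real x, b_n² h_n(x) → κ(x) := 2^{-1}(x² + 2x) e^{-x} as n → ∞. -/

import Mathlib

open Real MeasureTheory Filter Topology

/-- Standard normal density. -/
noncomputable def stdPhi (x : ℝ) : ℝ := (Real.sqrt (2 * Real.pi))⁻¹ * Real.exp (-(x ^ 2) / 2)

/-- Standard normal cdf. -/
noncomputable def stdCdf (x : ℝ) : ℝ := ∫ t in Set.Iic x, stdPhi t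

/-- Skew normal density with shape parameter l. -/
noncomputable def snPdf (l x : ℝ) : ℝ := 2 * stdPhi x * stdCdf (l * x)

/-- Skew normal cdf with shape parameter l. -/
noncomputable def snCdf (l x : ℝ) : ℝ := ∫ t in Set.Iic x, snPdf l t

/-- Gumbel extreme value distribution function. -/
noncomputable def gumbel (x : ℝ) : ℝ := Real.exp (-Real.exp (-x))

/-- $\kappa(x)$ for $\lambda>0$. -/
noncomputable def kappaPos (x : ℝ) : ℝ := 2⁻¹ * (x ^ 2 + 2 * x) * Real.exp (-x)

lemma aux_phi_eq : stdPhi = ProbabilityTheory.gaussianPDFReal 0 1 := by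
  funext x
  simp [stdPhi, ProbabilityTheory.gaussianPDFReal]

lemma aux_phi_pos (x : ℝ) : 0 < stdPhi x := by
  unfold stdPhi; positivity

lemma aux_phi_cont : Continuous stdPhi := by
  unfold stdPhi; fun_prop

lemma aux_phi_int : Integrable stdPhi := by
  rw [aux_phi_eq]; exact ProbabilityTheory.integrable_gaussianPDFReal 0 1

lemma aux_phi_total : ∫ t, stdPhi t = 1 := by
  rw [aux_phi_eq]; exact ProbabilityTheory.integral_gaussianPDFReal_eq_one 0 (by norm_num)

lemma aux_phi_neg (x : ℝ) : stdPhi (-x) = stdPhi x := by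
  simp [stdPhi]

lemma aux_phi_deriv (x : ℝ) : HasDerivAt stdPhi (-x * stdPhi x) x := by
  have h : HasDerivAt (fun x : ℝ => -(x ^ 2) / 2) (-x) x :=
    ((hasDerivAt_pow 2 x).neg.div_const 2).congr_deriv (by norm_num; ring)
  exact (h.exp.const_mul (Real.sqrt (2 * Real.pi))⁻¹).congr_deriv (by unfold stdPhi; ring)

/-- derivative of a cdf -/
lemma aux_cdf_deriv {f : ℝ → ℝ} (hc : Continuous f) (hi : Integrable f) (x : ℝ) :
    HasDerivAt (fun y => ∫ t in Set.Iic y, f t) (f x) x := by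
  have h1 : (fun y => ∫ t in Set.Iic y, f t)
      = fun y => (∫ t in Set.Iic (0:ℝ), f t) + ∫ t in (0:ℝ)..y, f t := by
    funext y
    rw [← intervalIntegral.integral_Iic_sub_Iic hi.integrableOn hi.integrableOn]
    ring
  rw [h1]
  exact (intervalIntegral.integral_hasDerivAt_right (hi.intervalIntegrable)
    (hc.stronglyMeasurableAtFilter _ _) hc.continuousAt).const_add _

lemma aux_cdf_lim {f : ℝ → ℝ} (hi : Integrable f) (ht : ∫ t, f t = 1) :
    Tendsto (fun y => ∫ t in Set.Iic y, f t) atTop (𝓝 1) := by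
  rw [← ht]
  exact (aecover_Iic tendsto_id).integral_tendsto_of_countably_generated hi

lemma aux_Phi_deriv (x : ℝ) : HasDerivAt stdCdf (stdPhi x) x :=
  aux_cdf_deriv aux_phi_cont aux_phi_int x

lemma aux_Phi_cont : Continuous stdCdf :=
  continuous_iff_continuousAt.2 fun x => (aux_Phi_deriv x).continuousAt

lemma aux_Phi_lim : Tendsto stdCdf atTop (𝓝 1) := aux_cdf_lim aux_phi_int aux_phi_total

lemma aux_Phi_neg (x : ℝ) : stdCdf x + stdCdf (-x) = 1 := by
  have h : stdCdf (-x) = ∫ t in Set.Ioi x, stdPhi t := by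
    unfold stdCdf
    rw [← integral_comp_neg_Ioi]
    simp only [aux_phi_neg]
  rw [h, stdCdf, ← aux_phi_total]
  have := integral_add_compl (μ := volume) (measurableSet_Iic (a := x)) aux_phi_int
  rwa [Set.compl_Iic] at this

lemma aux_Phi_pos (x : ℝ) : 0 < stdCdf x := by
  unfold stdCdf
  rw [setIntegral_pos_iff_support_of_nonneg_ae (ae_of_all _ fun t => (aux_phi_pos t).le)
    aux_phi_int.integrableOn]
  have : Function.support stdPhi = Set.univ := by
    ext t; simp [(aux_phi_pos t).ne']
  simp [this]

lemma aux_Phi_lt (x : ℝ) : stdCdf x < 1 := by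
  have := aux_Phi_neg x; have := aux_Phi_pos (-x); linarith

lemma aux_f_cont (l : ℝ) : Continuous (snPdf l) := by
  unfold snPdf
  exact (continuous_const.mul aux_phi_cont).mul (aux_Phi_cont.comp (continuous_const.mul continuous_id))

lemma aux_f_pos (l x : ℝ) : 0 < snPdf l x :=
  mul_pos (mul_pos two_pos (aux_phi_pos x)) (aux_Phi_pos _)

lemma aux_f_int (l : ℝ) : Integrable (snPdf l) := by
  refine (aux_phi_int.const_mul 2).mono' (aux_f_cont l).aestronglyMeasurable (ae_of_all _ fun x => ?_)
  rw [Real.norm_of_nonneg (aux_f_pos l x).le]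
  unfold snPdf
  have := aux_phi_pos x
  have := aux_Phi_lt (l * x)
  nlinarith

lemma aux_f_total (l : ℝ) : ∫ t, snPdf l t = 1 := by
  have h1 : ∫ t, snPdf l (-t) = ∫ t, snPdf l t := integral_neg_eq_self _ _
  have h2 : ∫ t, (snPdf l t + snPdf l (-t)) = 2 := by
    have : ∀ t, snPdf l t + snPdf l (-t) = 2 * stdPhi t := by
      intro t
      have := aux_Phi_neg (l * t)
      unfold snPdf
      rw [aux_phi_neg, mul_neg]
      linear_combination (2 * stdPhi t) * this
    simp_rw [this]
    rw [integral_const_mul, aux_phi_total]; norm_num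
  rw [integral_add (aux_f_int l) (aux_f_int l).comp_neg, h1] at h2
  linarith

lemma aux_F_deriv (l x : ℝ) : HasDerivAt (snCdf l) (snPdf l x) x :=
  aux_cdf_deriv (aux_f_cont l) (aux_f_int l) x

lemma aux_F_lim (l : ℝ) : Tendsto (snCdf l) atTop (𝓝 1) := aux_cdf_lim (aux_f_int l) (aux_f_total l)

lemma aux_F_mono (l : ℝ) : StrictMono (snCdf l) :=
  strictMono_of_hasDerivAt_pos (aux_F_deriv l) (aux_f_pos l)

lemma aux_F_lt (l x : ℝ) : snCdf l x < 1 :=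
  lt_of_lt_of_le (aux_F_mono l (lt_add_one x))
    ((aux_F_mono l).monotone.ge_of_tendsto (aux_F_lim l) _)

/-- `y^k φ(c y) → 0`. -/
lemma aux_pow_phi (k : ℕ) (c : ℝ) (hc : 0 < c) :
    Tendsto (fun y : ℝ => y ^ k * stdPhi (c * y)) atTop (𝓝 0) := by
  have h1 : Tendsto (fun y : ℝ => y ^ k * Real.exp (-y)) atTop (𝓝 0) :=
    tendsto_pow_mul_exp_neg_atTop_nhds_zero k
  have h2 : Tendsto (fun y : ℝ => (c * y)) atTop atTop := tendsto_id.const_mul_atTop hc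
  have h3 := (h1.const_mul ((Real.sqrt (2 * Real.pi))⁻¹ * (c ^ k)⁻¹)).comp h2
  rw [mul_zero] at h3
  refine squeeze_zero' ?_ ?_ h3
  · filter_upwards [eventually_ge_atTop 0] with y hy
    have := aux_phi_pos (c * y)
    positivity
  · filter_upwards [h2.eventually_ge_atTop 2, eventually_ge_atTop 0] with y hy hy0
    have e : Real.exp (-((c * y) ^ 2) / 2) ≤ Real.exp (-(c * y)) := by
      apply Real.exp_le_exp.2; nlinarith
    simp only [Function.comp]
    have e2 : (Real.sqrt (2 * Real.pi))⁻¹ * (c ^ k)⁻¹ * ((c * y) ^ k * Real.exp (-(c * y)))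
       = y ^ k * ((Real.sqrt (2 * Real.pi))⁻¹ * Real.exp (-(c * y))) := by
      rw [mul_pow]; field_simp
    rw [e2]
    unfold stdPhi
    gcongr

/-- `y^2 (1 - Φ(l y)) → 0`. -/
lemma aux_Phi_tail (l : ℝ) (hl : 0 < l) :
    Tendsto (fun y : ℝ => y ^ 2 * (1 - stdCdf (l * y))) atTop (𝓝 0) := by
  have key : Tendsto (fun y : ℝ => (1 - stdCdf (l * y)) / (y ^ 2)⁻¹) atTop (𝓝 0) := by
    refine HasDerivAt.lhopital_zero_atTop (f' := fun y => -(l * stdPhi (l * y)))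
      (g' := fun y => -(2 * y) / (y ^ 2) ^ 2) ?_ ?_ ?_ ?_ ?_ ?_
    · refine Eventually.of_forall fun y => ?_
      have h1 : HasDerivAt (fun y : ℝ => l * y) l y := by
        simpa using (hasDerivAt_id y).const_mul l
      have h2 := ((aux_Phi_deriv (l * y)).comp y h1).const_sub 1
      exact h2.congr_deriv (by ring)
    · filter_upwards [eventually_gt_atTop 0] with y hy
      have h2 : HasDerivAt (fun y : ℝ => y ^ 2) (2 * y) y := by simpa using hasDerivAt_pow 2 y
      exact h2.inv (by positivity)
    · filter_upwards [eventually_gt_atTop 0] with y hy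
      exact div_ne_zero (by simp [hy.ne']) (by positivity)
    · have h2 : Tendsto (fun y : ℝ => (l * y)) atTop atTop := tendsto_id.const_mul_atTop hl
      simpa using (aux_Phi_lim.comp h2).const_sub 1
    · exact (tendsto_pow_atTop (two_ne_zero)).inv_tendsto_atTop
    · have h := (aux_pow_phi 3 l hl).const_mul (l / 2)
      rw [mul_zero] at h
      refine h.congr' ?_
      filter_upwards [eventually_gt_atTop 0] with y hy
      field_simp
  refine key.congr fun y => ?_
  rw [div_inv_eq_mul, mul_comm]

lemma aux_inv_sq : Tendsto (fun y : ℝ => (y ^ 2)⁻¹) atTop (𝓝 0) :=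
  (tendsto_pow_atTop (two_ne_zero)).inv_tendsto_atTop

/-- The normalised tail. -/
noncomputable def auxR (l y : ℝ) : ℝ := (1 - snCdf l y) * y / (2 * stdPhi y)

lemma aux_phi_lim : Tendsto stdPhi atTop (𝓝 0) := by
  simpa using aux_pow_phi 0 1 one_pos

lemma aux_R_lim (l : ℝ) (hl : 0 < l) :
    Tendsto (fun y : ℝ => y ^ 2 * (auxR l y - 1)) atTop (𝓝 (-1)) := by
  have key : Tendsto (fun y : ℝ => ((1 - snCdf l y) - 2 * stdPhi y / y) / (2 * stdPhi y / y ^ 3))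
      atTop (𝓝 (-1)) := by
    refine HasDerivAt.lhopital_zero_atTop
      (f' := fun y => -snPdf l y - (2 * (-y * stdPhi y) * y - 2 * stdPhi y * 1) / y ^ 2)
      (g' := fun y => (2 * (-y * stdPhi y) * y ^ 3 - 2 * stdPhi y * (3 * y ^ 2)) / (y ^ 3) ^ 2)
      ?_ ?_ ?_ ?_ ?_ ?_
    · filter_upwards [eventually_gt_atTop 0] with y hy
      exact ((aux_F_deriv l y).const_sub 1).sub
        (((aux_phi_deriv y).const_mul 2).div (hasDerivAt_id y) hy.ne')
    · filter_upwards [eventually_gt_atTop 0] with y hy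
      have h2 : HasDerivAt (fun y : ℝ => y ^ 3) (3 * y ^ 2) y := by simpa using hasDerivAt_pow 3 y
      exact ((aux_phi_deriv y).const_mul 2).div h2 (by positivity)
    · filter_upwards [eventually_gt_atTop 0] with y hy
      have := aux_phi_pos y
      have e : 2 * (-y * stdPhi y) * y ^ 3 - 2 * stdPhi y * (3 * y ^ 2)
        = -(2 * stdPhi y * (y ^ 4 + 3 * y ^ 2)) := by ring
      rw [e]
      exact div_ne_zero (neg_ne_zero.2 (by positivity)) (by positivity)
    · have h1 := (aux_F_lim l).const_sub 1
      have h2 := (aux_phi_lim.const_mul 2).mul tendsto_inv_atTop_zero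
      simpa [div_eq_mul_inv] using h1.sub h2
    · have h2 := (aux_phi_lim.const_mul 2).mul
        ((tendsto_pow_atTop (α := ℝ) (three_ne_zero)).inv_tendsto_atTop)
      simpa [div_eq_mul_inv] using h2
    · have h1 : Tendsto (fun y : ℝ => -(y ^ 2 * (1 - stdCdf (l * y)) + 1) / (1 + 3 * (y ^ 2)⁻¹))
          atTop (𝓝 (-(0 + 1) / (1 + 3 * 0))) :=
        ((aux_Phi_tail l hl).add_const 1).neg.div ((aux_inv_sq.const_mul 3).const_add 1)
          (by norm_num)
      rw [show (-(0 + 1) / (1 + 3 * 0) : ℝ) = -1 by norm_num] at h1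
      refine h1.congr' ?_
      filter_upwards [eventually_gt_atTop 0] with y hy
      have := aux_phi_pos y
      unfold snPdf
      have e : 2 * (-y * stdPhi y) * y ^ 3 - 2 * stdPhi y * (3 * y ^ 2)
        = -(2 * stdPhi y * y ^ 2 * (y ^ 2 + 3)) := by ring
      rw [e]
      field_simp
      ring
  refine key.congr' ?_
  filter_upwards [eventually_gt_atTop 0] with y hy
  have := aux_phi_pos y
  unfold auxR
  field_simp

lemma aux_R_one (l : ℝ) (hl : 0 < l) : Tendsto (auxR l) atTop (𝓝 1) := by
  have h := ((aux_R_lim l hl).mul aux_inv_sq).add_const 1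
  simp only [mul_zero, zero_add] at h
  refine h.congr' ?_
  filter_upwards [eventually_gt_atTop 0] with y hy
  field_simp
  ring

lemma aux_T_eq (l y : ℝ) (hy : 0 < y) : 1 - snCdf l y = 2 * stdPhi y / y * auxR l y := by
  have := aux_phi_pos y
  unfold auxR
  field_simp

/-- `y^2 T(y) → 0`. -/
lemma aux_T_sq (l : ℝ) (hl : 0 < l) :
    Tendsto (fun y : ℝ => y ^ 2 * (1 - snCdf l y)) atTop (𝓝 0) := by
  have h := ((aux_pow_phi 1 1 one_pos).const_mul 2).mul (aux_R_one l hl)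
  simp only [mul_zero, zero_mul, one_mul, pow_one] at h
  refine h.congr' ?_
  filter_upwards [eventually_gt_atTop 0] with y hy
  rw [aux_T_eq l y hy]
  field_simp

lemma aux_u_lim (x : ℝ) : Tendsto (fun y : ℝ => y + x / y) atTop atTop := by
  refine tendsto_id.atTop_add (C := 0) ?_
  exact tendsto_const_nhds.div_atTop tendsto_id

lemma aux_exp_lim (c : ℝ) :
    Tendsto (fun y : ℝ => y ^ 2 * (Real.exp (c * (y ^ 2)⁻¹) - 1)) atTop (𝓝 c) := by
  have h1 : HasDerivAt (fun s : ℝ => Real.exp (c * s)) c 0 := by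
    have h := ((hasDerivAt_id (0:ℝ)).const_mul c).exp
    simpa using h
  have h2 := hasDerivAt_iff_tendsto_slope_zero.1 h1
  have h3 : Tendsto (fun y : ℝ => (y ^ 2)⁻¹) atTop (𝓝[≠] 0) := by
    refine tendsto_nhdsWithin_iff.2 ⟨aux_inv_sq, ?_⟩
    filter_upwards [eventually_gt_atTop 0] with y hy
    have : (y ^ 2)⁻¹ ≠ 0 := by positivity
    simpa using this
  have h4 := h2.comp h3
  refine h4.congr fun y => ?_
  simp

lemma aux_ratio (l : ℝ) (hl : 0 < l) (x : ℝ) :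
    Tendsto (fun y : ℝ => y ^ 2 * ((1 - snCdf l (y + x / y)) / (1 - snCdf l y) - Real.exp (-x)))
      atTop (𝓝 (-kappaPos x)) := by
  have hA := aux_exp_lim (-(x ^ 2) / 2)
  have hden : Tendsto (fun y : ℝ => 1 + x * (y ^ 2)⁻¹) atTop (𝓝 1) := by
    simpa using (aux_inv_sq.const_mul x).const_add 1
  have hB1 : Tendsto (fun y : ℝ => (1 + x * (y ^ 2)⁻¹)⁻¹) atTop (𝓝 1) := by
    simpa using hden.inv₀ one_ne_zero
  have hB : Tendsto (fun y : ℝ => y ^ 2 * ((1 + x * (y ^ 2)⁻¹)⁻¹ - 1)) atTop (𝓝 (-x)) := by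
    have h := hB1.const_mul (-x)
    rw [mul_one] at h
    refine h.congr' ?_
    filter_upwards [eventually_gt_atTop 0, hden.eventually_ne one_ne_zero] with y hy h0
    have e : y ^ 2 * (y ^ 2)⁻¹ = 1 := mul_inv_cancel₀ (by positivity)
    have e2 : (1 + x * (y ^ 2)⁻¹) * (1 + x * (y ^ 2)⁻¹)⁻¹ = 1 := mul_inv_cancel₀ h0
    linear_combination (-y ^ 2) * e2 + x * (1 + x * (y ^ 2)⁻¹)⁻¹ * e
  have hRy := aux_R_lim l hl
  have hR1 := aux_R_one l hl
  have hRu1 := hR1.comp (aux_u_lim x)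
  have hRu : Tendsto (fun y : ℝ => y ^ 2 * (auxR l (y + x / y) - 1)) atTop (𝓝 (-1)) := by
    have h := (hB1.pow 2).mul (hRy.comp (aux_u_lim x))
    simp only [one_pow, one_mul] at h
    refine h.congr' ?_
    filter_upwards [eventually_gt_atTop 0, hden.eventually_ne one_ne_zero] with y hy h0
    have e : y + x / y = y * (1 + x * (y ^ 2)⁻¹) := by field_simp
    simp only [Function.comp]
    generalize auxR l (y + x / y) = r
    rw [e]
    generalize 1 + x * (y ^ 2)⁻¹ = w at *
    field_simp
  have hC1 : Tendsto (fun y : ℝ => auxR l (y + x / y) / auxR l y) atTop (𝓝 1) := by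
    have h := hRu1.div hR1 one_ne_zero
    rw [div_one] at h
    exact h
  have hC : Tendsto (fun y : ℝ => y ^ 2 * (auxR l (y + x / y) / auxR l y - 1)) atTop (𝓝 0) := by
    have h := (hRu.sub hRy).div hR1 one_ne_zero
    rw [sub_self, zero_div] at h
    refine h.congr' ?_
    filter_upwards [hR1.eventually_ne one_ne_zero] with y h0
    simp only [Pi.div_apply]
    field_simp
    ring
  have hfin := (((hA.mul (hB1.mul hC1)).add (hB.mul hC1)).add hC).const_mul (Real.exp (-x))
  have e : Real.exp (-x) * (-(x ^ 2) / 2 * (1 * 1) + -x * 1 + 0) = -kappaPos x := by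
    unfold kappaPos; ring
  rw [e] at hfin
  refine hfin.congr' ?_
  filter_upwards [eventually_gt_atTop 0, hden.eventually_ne one_ne_zero,
    (aux_u_lim x).eventually_gt_atTop 0, hR1.eventually_ne one_ne_zero] with y hy h0 hu hr
  have hphi : stdPhi (y + x / y)
      = stdPhi y * (Real.exp (-x) * Real.exp (-(x ^ 2) / 2 * (y ^ 2)⁻¹)) := by
    unfold stdPhi
    rw [mul_assoc, ← Real.exp_add, ← Real.exp_add]
    congr 2
    field_simp
    ring
  have hrat : (1 - snCdf l (y + x / y)) / (1 - snCdf l y)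
      = Real.exp (-x) * (Real.exp (-(x ^ 2) / 2 * (y ^ 2)⁻¹) * ((1 + x * (y ^ 2)⁻¹)⁻¹
        * (auxR l (y + x / y) / auxR l y))) := by
    rw [aux_T_eq l _ hu, aux_T_eq l y hy, hphi]
    have hp := (aux_phi_pos y).ne'
    have e : y + x / y = y * (1 + x * (y ^ 2)⁻¹) := by field_simp
    generalize auxR l (y + x / y) = r
    rw [e]
    generalize 1 + x * (y ^ 2)⁻¹ = w at *
    field_simp
  rw [hrat]
  ring

lemma aux_b_lim (l : ℝ) (b : ℕ → ℝ)
    (hb : ∀ n : ℕ, 2 ≤ n → snCdf l (b n) = 1 - 1 / n) : Tendsto b atTop atTop := by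
  refine tendsto_atTop.2 fun M => ?_
  have h1 : Tendsto (fun n : ℕ => (1 : ℝ) - 1 / n) atTop (𝓝 1) := by
    simpa using tendsto_one_div_atTop_nhds_zero_nat.const_sub (1 : ℝ)
  filter_upwards [h1.eventually_const_lt (aux_F_lt l M), eventually_ge_atTop 2] with n hn h2
  rw [← hb n h2] at hn
  exact ((aux_F_mono l).lt_iff_lt.1 hn).le

lemma aux_log {t : ℝ} (h0 : 0 ≤ t) (h1 : t ≤ 1 / 2) : |Real.log (1 - t) + t| ≤ 2 * t ^ 2 := by
  have hp : 0 < 1 - t := by linarith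
  have ha := Real.log_le_sub_one_of_pos hp
  have hb := Real.one_sub_inv_le_log_of_pos hp
  have hc : (1 - t)⁻¹ ≤ 1 + t + 2 * t ^ 2 := by
    rw [inv_le_iff_one_le_mul₀ hp]
    nlinarith [mul_nonneg (sq_nonneg t) (by linarith : 0 ≤ 1 - 2 * t)]
  rw [abs_le]
  constructor <;> nlinarith

lemma aux_main (l : ℝ) (hl : 0 < l) (x : ℝ) :
    Tendsto (fun y : ℝ => y ^ 2 * ((1 - snCdf l y)⁻¹ * Real.log (snCdf l (y + x / y))
      + Real.exp (-x))) atTop (𝓝 (kappaPos x)) := by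
  have hr := aux_ratio l hl x
  have hr1 : Tendsto (fun y : ℝ => (1 - snCdf l (y + x / y)) / (1 - snCdf l y)) atTop
      (𝓝 (Real.exp (-x))) := by
    have h := (hr.mul aux_inv_sq).add_const (Real.exp (-x))
    simp only [mul_zero, zero_add] at h
    refine h.congr' ?_
    filter_upwards [eventually_gt_atTop 0] with y hy
    field_simp
    ring
  have hE : Tendsto (fun y : ℝ => y ^ 2 * ((1 - snCdf l y)⁻¹ *
      (Real.log (snCdf l (y + x / y)) + (1 - snCdf l (y + x / y))))) atTop (𝓝 0) := by
    have hbd := ((aux_T_sq l hl).mul (hr1.pow 2)).const_mul 2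
    simp only [zero_mul, mul_zero] at hbd
    refine squeeze_zero_norm' ?_ hbd
    have hF := ((aux_F_lim l).comp (aux_u_lim x)).eventually_const_lt
      (show (1 / 2 : ℝ) < 1 by norm_num)
    filter_upwards [hF] with y hy
    simp only [Function.comp] at hy
    have hT : 0 < 1 - snCdf l y := sub_pos.2 (aux_F_lt l y)
    have hlog := aux_log (t := 1 - snCdf l (y + x / y)) (sub_pos.2 (aux_F_lt l _)).le (by linarith)
    rw [sub_sub_cancel] at hlog
    rw [Real.norm_eq_abs, abs_mul, abs_mul, abs_of_nonneg (sq_nonneg y),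
      abs_of_pos (inv_pos.2 hT)]
    calc _ ≤ y ^ 2 * ((1 - snCdf l y)⁻¹ * (2 * (1 - snCdf l (y + x / y)) ^ 2)) := by gcongr
      _ = _ := by field_simp
  have h := hE.sub hr
  rw [zero_sub, neg_neg] at h
  refine h.congr fun y => ?_
  ring

theorem skew_normal_h_limit_pos (l : ℝ) (hl : 0 < l) (b : ℕ → ℝ)
    (hb : ∀ n : ℕ, 2 ≤ n → snCdf l (b n) = 1 - 1 / n) (x : ℝ) :
    Tendsto (fun n : ℕ =>
      (b n) ^ 2 * ((n : ℝ) * Real.log (snCdf l (b n + x / b n)) + Real.exp (-x)))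
      atTop (𝓝 (kappaPos x)) := by
  refine ((aux_main l hl x).comp (aux_b_lim l b hb)).congr' ?_
  filter_upwards [eventually_ge_atTop 2] with n hn
  simp only [Function.comp]
  rw [hb n hn]
  simp
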